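/- Let p be a prime and f : 𝔽_{p^n} → 𝔽_p a function. Then f is s-plateaued if and only if for every u ∈ 𝔽_{p^n}, ∑_{a ∈ 𝔽_{p^n}} ∑_{b ∈ 𝔽_{p^n}} ζ_p^{D_a D_b f(u)} = p^{n+s}, where D_a D_b f(u) = f(u + a + b) + f(u) − f(u + a) − f(u + b); in particular this double sum does not depend on u. -/

import Mathlib

open scoped BigOperators Classical

noncomputable instance galFintype (p n : ℕ) [Fact p.Prime] : Fintype (GaloisField p n) :=
  Fintype.ofFinite _

/-- `eChar p k = ζ_p ^ k` where `ζ_p = exp(2πi/p)` and `k : ZMod p`. -/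
noncomputable def eChar (p : ℕ) (k : ZMod p) : ℂ :=
  Complex.exp (2 * Real.pi * Complex.I / p) ^ k.val

/-- Absolute trace `Tr_n : 𝔽_{p^n} → 𝔽_p`. -/
noncomputable def trGF (p n : ℕ) [Fact p.Prime] (x : GaloisField p n) : ZMod p :=
  Algebra.trace (ZMod p) (GaloisField p n) x

/-- Walsh transform `f̂(μ) = ∑_x ζ_p^{f(x) - Tr_n(μ x)}`. -/
noncomputable def walsh (p n : ℕ) [Fact p.Prime] (f : GaloisField p n → ZMod p)
    (μ : GaloisField p n) : ℂ :=
  ∑ x : GaloisField p n, eChar p (f x - trGF p n (μ * x))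

/-- `f` is `s`-plateaued: `|f̂(μ)| ∈ {0, p^{(n+s)/2}}` for all `μ`. -/
def IsPlateaued (p n : ℕ) [Fact p.Prime] (f : GaloisField p n → ZMod p) (s : ℕ) : Prop :=
  ∀ μ : GaloisField p n, ‖walsh p n f μ‖ = 0 ∨
    ‖walsh p n f μ‖ = (p : ℝ) ^ (((n : ℝ) + (s : ℝ)) / 2)

/-- `δ_S(g) = #{(s,t) ∈ S × S : g = s - t}`. -/
def pgdsDelta {G : Type*} [AddCommGroup G] [DecidableEq G] (S : Finset G) (g : G) : ℕ :=
  ((S ×ˢ S).filter fun st => g = st.1 - st.2).card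

/-- `S` is a partial geometric difference set with parameters `(v, k; α, β)`. -/
def IsPGDS {G : Type*} [AddCommGroup G] [Fintype G] [DecidableEq G]
    (S : Finset G) (v k α β : ℕ) : Prop :=
  Fintype.card G = v ∧ S.card = k ∧
    ∀ x : G, (∑ y ∈ S, pgdsDelta S (x - y)) = if x ∈ S then β else α

open scoped ComplexConjugate

section Fourier

variable {K : Type*} [Field K] [Fintype K]

/-- The Fourier transform on a finite field with respect to the additive character `ψ`. -/
noncomputable def fieldFourier (ψ : AddChar K ℂ) (g : K → ℂ) (μ : K) : ℂ :=
  ∑ x, g x * ψ (-(μ * x))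

theorem sum_fieldFourier_mul {ψ : AddChar K ℂ} (hψ : ψ.IsPrimitive) (g : K → ℂ) (u : K) :
    ∑ μ, fieldFourier ψ g μ * ψ (μ * u) = Fintype.card K * g u := by
  simp only [fieldFourier, Finset.sum_mul]
  rw [Finset.sum_comm]
  have h (x : K) : ∑ μ, g x * ψ (-(μ * x)) * ψ (μ * u) =
      if u = x then (Fintype.card K : ℂ) * g x else 0 := by
    have := AddChar.sum_mulShift (u - x) hψ
    calc ∑ μ, g x * ψ (-(μ * x)) * ψ (μ * u) = g x * ∑ μ, ψ (μ * (u - x)) := by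
          rw [Finset.mul_sum]
          refine Finset.sum_congr rfl fun μ _ => ?_
          rw [mul_assoc, ← AddChar.map_add_eq_mul]
          congr 2
          ring
      _ = _ := by
          rw [this]
          simp only [sub_eq_zero]
          split_ifs <;> simp [mul_comm]
  simp [h]

theorem fieldFourier_injective {ψ : AddChar K ℂ} (hψ : ψ.IsPrimitive) :
    Function.Injective (fieldFourier ψ) := by
  intro g h hgh
  funext u
  have hcard : (Fintype.card K : ℂ) ≠ 0 := by simp
  apply mul_left_cancel₀ hcard
  rw [← sum_fieldFourier_mul hψ, ← sum_fieldFourier_mul hψ, hgh]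

/-- The Fourier transform turns the triple correlation into a product. -/
theorem fieldFourier_tripleCorrelation (ψ : AddChar K ℂ) (g : K → ℂ) (μ : K) :
    fieldFourier ψ (fun u => ∑ a, ∑ b, g (u + a) * g (u + b) * conj (g (u + a + b))) μ =
      fieldFourier ψ g μ * fieldFourier ψ g μ * conj (fieldFourier ψ g μ) := by
  have hshift (u : K) : ∑ a, ∑ b, g (u + a) * g (u + b) * conj (g (u + a + b)) =
      ∑ x, ∑ y, g x * g y * conj (g (x + y - u)) := by
    refine Fintype.sum_equiv (Equiv.addLeft u) _ _ fun a => ?_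
    refine Fintype.sum_equiv (Equiv.addLeft u) _ _ fun b => ?_
    simp only [Equiv.coe_addLeft]
    congr 3
    ring
  simp only [fieldFourier, hshift, map_sum, map_mul, Finset.sum_mul_sum]
  simp only [Finset.sum_mul]
  rw [Finset.sum_comm]
  refine Finset.sum_congr rfl fun x _ => ?_
  rw [Finset.sum_comm]
  conv_rhs => rw [Finset.sum_comm]
  refine Finset.sum_congr rfl fun y _ => ?_
  refine Fintype.sum_equiv (Equiv.subLeft (x + y)) _ _ fun u => ?_
  have hψ : ψ (-(μ * u)) =
      ψ (-(μ * x)) * ψ (-(μ * y)) * ψ (μ * (x + y - u)) := by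
    rw [← AddChar.map_add_eq_mul, ← AddChar.map_add_eq_mul]
    congr 1
    ring
  rw [Equiv.subLeft_apply, ← AddChar.map_neg_eq_conj, neg_neg, hψ]
  ring

/-- A unimodular function has constant second multiplicative derivative sums `c`
iff the squared modulus of its Fourier transform only takes the values `0` and `c`. -/
theorem sum_secondDerivative_eq_iff {ψ : AddChar K ℂ} (hψ : ψ.IsPrimitive) {g : K → ℂ}
    (hg : ∀ x, ‖g x‖ = 1) (c : ℝ) :
    (∀ u, ∑ a, ∑ b, g (u + a + b) * g u * conj (g (u + a)) * conj (g (u + b)) = c) ↔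
      ∀ μ, ‖fieldFourier ψ g μ‖ = 0 ∨ ‖fieldFourier ψ g μ‖ ^ 2 = c := by
  have hgg (u : K) : g u * conj (g u) = 1 := by
    rw [Complex.mul_conj', hg]
    simp
  have hg0 (u : K) : g u ≠ 0 := left_ne_zero_of_mul_eq_one (hgg u)
  have hderiv (u : K) :
      ∑ a, ∑ b, g (u + a + b) * g u * conj (g (u + a)) * conj (g (u + b)) = c ↔
        ∑ a, ∑ b, g (u + a) * g (u + b) * conj (g (u + a + b)) = c * g u := by
    rw [← (starRingEnd ℂ).injective.eq_iff, ← mul_right_inj' (hg0 u), Complex.conj_ofReal,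
      mul_comm (g u) (c : ℂ)]
    refine Eq.congr_left ?_
    simp only [map_sum, map_mul, Complex.conj_conj, Finset.mul_sum]
    refine Finset.sum_congr rfl fun a _ => Finset.sum_congr rfl fun b _ => ?_
    linear_combination (g (u + a) * g (u + b) * conj (g (u + a + b))) * hgg u
  have hsmul (μ : K) : fieldFourier ψ (fun u => c * g u) μ = c * fieldFourier ψ g μ := by
    simp only [fieldFourier, Finset.mul_sum, mul_assoc]
  simp only [hderiv]
  rw [← funext_iff (f := fun u => ∑ a, ∑ b, g (u + a) * g (u + b) * conj (g (u + a + b)))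
    (g := fun u => c * g u), ← (fieldFourier_injective hψ).eq_iff, funext_iff]
  refine forall_congr' fun μ => ?_
  rw [fieldFourier_tripleCorrelation, hsmul, mul_assoc, Complex.mul_conj',
    mul_comm (c : ℂ), mul_eq_mul_left_iff, norm_eq_zero, or_comm]
  norm_cast

end Fourier

theorem eChar_eq_stdAddChar (p : ℕ) [NeZero p] (k : ZMod p) :
    eChar p k = ZMod.stdAddChar k := by
  rw [eChar, ← Complex.exp_nat_mul]
  conv_rhs => rw [← ZMod.natCast_zmod_val k]
  rw [← Int.cast_natCast (R := ZMod p), ZMod.stdAddChar_coe]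
  congr 1
  push_cast
  ring

/-- The canonical additive character `x ↦ ζ_p ^ Tr x` of `𝔽_{p^n}`. -/
noncomputable def traceChar (p n : ℕ) [Fact p.Prime] : AddChar (GaloisField p n) ℂ :=
  (ZMod.stdAddChar (N := p)).compAddMonoidHom
    (Algebra.trace (ZMod p) (GaloisField p n)).toAddMonoidHom

theorem traceChar_apply (p n : ℕ) [Fact p.Prime] (x : GaloisField p n) :
    traceChar p n x = ZMod.stdAddChar (trGF p n x) :=
  rfl

theorem traceChar_isPrimitive (p n : ℕ) [Fact p.Prime] : (traceChar p n).IsPrimitive := by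
  refine AddChar.IsPrimitive.of_ne_one fun h => ?_
  obtain ⟨x, hx⟩ := Algebra.trace_surjective (ZMod p) (GaloisField p n) 1
  have h1 : ZMod.stdAddChar (1 : ZMod p) = (1 : ℂ) := by
    rw [← hx]
    exact DFunLike.congr_fun h x
  rw [← AddChar.map_zero_eq_one (ZMod.stdAddChar (N := p))] at h1
  exact one_ne_zero (ZMod.injective_stdAddChar h1)

theorem walsh_eq_fieldFourier (p n : ℕ) [Fact p.Prime] (f : GaloisField p n → ZMod p)
    (μ : GaloisField p n) :
    walsh p n f μ = fieldFourier (traceChar p n) (fun x => ZMod.stdAddChar (f x)) μ := by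
  refine Finset.sum_congr rfl fun x _ => ?_
  rw [eChar_eq_stdAddChar, traceChar_apply, ← AddChar.map_add_eq_mul, sub_eq_add_neg]
  simp only [trGF, map_neg]

/-- `f` is `s`-plateaued iff for every `u`,
`∑_{a,b} ζ_p^{D_a D_b f(u)} = p^{n+s}` (in particular the sum does not depend on `u`). -/
theorem stmt10 (p n : ℕ) [Fact p.Prime] (hn : 0 < n) (s : ℕ)
    (f : GaloisField p n → ZMod p) :
    IsPlateaued p n f s ↔
      ∀ u : GaloisField p n,
        (∑ a : GaloisField p n, ∑ b : GaloisField p n,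
          eChar p (f (u + a + b) + f u - f (u + a) - f (u + b))) = (p : ℂ) ^ (n + s) := by
  have hp : (0 : ℝ) ≤ p := Nat.cast_nonneg p
  have hsq : ((p : ℝ) ^ (((n : ℝ) + (s : ℝ)) / 2)) ^ 2 = (p : ℝ) ^ (n + s) := by
    rw [← Real.rpow_natCast, ← Real.rpow_mul hp, ← Real.rpow_natCast]
    congr 1
    push_cast
    ring
  have hmain := sum_secondDerivative_eq_iff (traceChar_isPrimitive p n)
    (g := fun x => ZMod.stdAddChar (f x)) (fun x => AddChar.norm_apply _ _) ((p : ℝ) ^ (n + s))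
  have hterm (u a b : GaloisField p n) :
      eChar p (f (u + a + b) + f u - f (u + a) - f (u + b)) =
        ZMod.stdAddChar (f (u + a + b)) * ZMod.stdAddChar (f u) *
          conj (ZMod.stdAddChar (f (u + a)) : ℂ) * conj (ZMod.stdAddChar (f (u + b)) : ℂ) := by
    simp only [eChar_eq_stdAddChar, sub_eq_add_neg, AddChar.map_add_eq_mul,
      AddChar.map_neg_eq_conj]
  push_cast at hmain
  simp only [hterm]
  rw [hmain]
  refine forall_congr' fun μ => ?_
  rw [walsh_eq_fieldFourier, ← hsq,
    pow_left_inj₀ (norm_nonneg _) (Real.rpow_nonneg hp _) two_ne_zero]
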